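/- arXiv:2603.02610 — 2 statements merged into one kernel-verified Lean document; each statement's English description precedes it below -/
import Mathlib

section
/- Let N ≥ 2, let B be a nonnegative integer, and let c = (c_1,…,c_N) be a vector of nonnegative integers. Define 𝒴(c) = { y ∈ ℤ_{≥0}^ℱ : Σ_{j<i} y_{ji} + Σ_{j>i} y_{ij} ≤ c_i for every node i, and Σ_{i<j} y_{ij} ≤ B }. Then max_{y ∈ 𝒴(c)} Σ_{i<j} y_{ij} = min{ B, ⌊(Σ_i c_i)/2⌋, Σ_i c_i − max_i c_i }. -/
open Finset

/-- Total number of scheduled swaps over unordered pairs `i < j`. -/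
def pairTotal (N : ℕ) (y : Fin N → Fin N → ℕ) : ℕ :=
  ∑ i : Fin N, ∑ j : Fin N, if i < j then y i j else 0

/-- Degree of the schedule at node `i`: `∑_{j<i} y_{ji} + ∑_{j>i} y_{ij}`. -/
def nodeDeg (N : ℕ) (y : Fin N → Fin N → ℕ) (i : Fin N) : ℕ :=
  (∑ j : Fin N, if j < i then y j i else 0) + (∑ j : Fin N, if i < j then y i j else 0)

theorem bump_lt (N : ℕ) (y : Fin N → Fin N → ℕ) (a b : Fin N) (hab : a < b) :
    ∃ z : Fin N → Fin N → ℕ, pairTotal N z = pairTotal N y + 1 ∧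
      ∀ i, nodeDeg N z i = nodeDeg N y i + ((if i = a then 1 else 0) + (if i = b then 1 else 0)) := by
  have key : ∀ i j : Fin N, (if i < j then (y i j + if i = a then (if j = b then 1 else 0) else 0) else 0)
      = (if i < j then y i j else 0) + if i = a then (if j = b then 1 else 0) else 0 := by
    intro i j
    split_ifs <;> first | rfl | (subst_vars; contradiction)
  refine ⟨fun i j => y i j + if i = a then (if j = b then 1 else 0) else 0, ?_, ?_⟩
  · unfold pairTotal
    simp only [key, sum_add_distrib]
    congr 1
    rw [sum_eq_single a]
    · simp
    · intro i _ hi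
      simp [hi]
    · simp
  · intro i
    unfold nodeDeg
    simp only [key, sum_add_distrib]
    have h1 : (∑ j : Fin N, if j = a then (if i = b then 1 else 0) else 0) = if i = b then 1 else 0 := by
      simp
    have h2 : (∑ j : Fin N, if i = a then (if j = b then 1 else 0) else 0) = if i = a then 1 else 0 := by
      by_cases h : i = a <;> simp [h]
    rw [h1, h2]
    omega

theorem bump_ne (N : ℕ) (y : Fin N → Fin N → ℕ) (a b : Fin N) (hab : a ≠ b) :
    ∃ z : Fin N → Fin N → ℕ, pairTotal N z = pairTotal N y + 1 ∧
      ∀ i, nodeDeg N z i = nodeDeg N y i + ((if i = a then 1 else 0) + (if i = b then 1 else 0)) := by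
  rcases lt_or_gt_of_ne hab with h | h
  · exact bump_lt N y a b h
  · obtain ⟨z, h1, h2⟩ := bump_lt N y b a h
    exact ⟨z, h1, fun i => by rw [h2 i]; omega⟩

theorem exists_schedule (N : ℕ) (hN : 2 ≤ N) (k : ℕ) : ∀ (c : Fin N → ℕ),
    2 * k ≤ ∑ i, c i → (∀ i, k + c i ≤ ∑ i, c i) →
    ∃ y : Fin N → Fin N → ℕ, (∀ i, nodeDeg N y i ≤ c i) ∧ pairTotal N y = k := by
  induction k with
  | zero =>
    intro c _ _
    exact ⟨fun _ _ => 0, fun i => by simp [nodeDeg], by simp [pairTotal]⟩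
  | succ k ih =>
    intro c h1 h2
    have : Nontrivial (Fin N) := Fin.nontrivial_iff_two_le.mpr hN
    obtain ⟨a, -, ha⟩ := exists_max_image (univ : Finset (Fin N)) c ⟨⟨0, by omega⟩, mem_univ _⟩
    obtain ⟨b0, hb0⟩ := exists_ne a
    obtain ⟨b, hb, hbm⟩ := exists_max_image (univ.erase a) c ⟨b0, by simp [hb0]⟩
    have hba : b ≠ a := ne_of_mem_erase hb
    have sa : c a + ∑ i ∈ univ.erase a, c i = ∑ i, c i := add_sum_erase _ _ (mem_univ a)
    have sb : c b + ∑ i ∈ (univ.erase a).erase b, c i = ∑ i ∈ univ.erase a, c i :=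
      add_sum_erase _ _ hb
    have hcb : 1 ≤ c b := by
      by_contra h
      have : ∑ i ∈ univ.erase a, c i = 0 := sum_eq_zero fun i hi => by
        have := hbm i hi
        omega
      have := h2 a
      omega
    have hca : 1 ≤ c a := hcb.trans (ha b (mem_univ _))
    set d : Fin N → ℕ := fun i => c i - ((if i = a then 1 else 0) + (if i = b then 1 else 0)) with hd
    have hdc : ∀ i, d i + ((if i = a then 1 else 0) + (if i = b then 1 else 0)) = c i := by
      intro i
      simp only [hd]
      by_cases h : i = a
      · have : i ≠ b := fun h' => hba (h'.symm.trans h)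
        simp only [if_pos h, if_neg this]
        subst h
        omega
      · by_cases h' : i = b
        · simp only [if_neg h, if_pos h']
          subst h'
          omega
        · simp [h, h']
    have hs : ∑ i, d i + 2 = ∑ i, c i := by
      rw [← sum_congr rfl fun i _ => hdc i]
      simp [sum_add_distrib]
    obtain ⟨y, hy1, hy2⟩ := ih d (by omega) (by
      intro i
      have e := hdc i
      have := h2 i
      by_cases h : i = a
      · rw [if_pos h] at e
        omega
      · by_cases h' : i = b
        · rw [if_pos h'] at e
          omega
        · rw [if_neg h, if_neg h'] at e
          have m1 := ha i (mem_univ _)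
          have m2 := hbm i (by simp [h])
          have m3 : c i ≤ ∑ i ∈ (univ.erase a).erase b, c i :=
            single_le_sum (f := c) (fun _ _ => Nat.zero_le _) (by simp [h, h'])
          omega)
    obtain ⟨z, hz1, hz2⟩ := bump_ne N y a b hba.symm
    refine ⟨z, fun i => ?_, by rw [hz1, hy2]⟩
    rw [hz2, ← hdc i]
    exact Nat.add_le_add_right (hy1 i) _

theorem sum_nodeDeg (N : ℕ) (y : Fin N → Fin N → ℕ) : ∑ i, nodeDeg N y i = 2 * pairTotal N y := by
  unfold nodeDeg pairTotal
  rw [sum_add_distrib, sum_comm]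
  omega

theorem nodeDeg_le (N : ℕ) (y : Fin N → Fin N → ℕ) (m : Fin N) : nodeDeg N y m ≤ pairTotal N y := by
  unfold nodeDeg pairTotal
  rw [← add_sum_erase (univ : Finset (Fin N)) (fun i => ∑ j : Fin N, if i < j then y i j else 0) (mem_univ m),
    ← add_sum_erase (univ : Finset (Fin N)) (fun j => if j < m then y j m else 0) (mem_univ m)]
  have : ∑ j ∈ univ.erase m, (if j < m then y j m else 0) ≤
      ∑ i ∈ univ.erase m, ∑ j : Fin N, if i < j then y i j else 0 :=
    sum_le_sum fun i _ => single_le_sum (f := fun j => if i < j then y i j else 0)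
      (fun _ _ => Nat.zero_le _) (mem_univ m)
  simp only [lt_irrefl, if_false]
  omega

theorem stmt6 (N : ℕ) (hN : 2 ≤ N) (B : ℕ) (c : Fin N → ℕ) :
    IsGreatest
      {t : ℕ | ∃ y : Fin N → Fin N → ℕ,
        (∀ i, nodeDeg N y i ≤ c i) ∧ pairTotal N y ≤ B ∧ t = pairTotal N y}
      (min B (min ((∑ i, c i) / 2) ((∑ i, c i) - Finset.univ.sup c))) := by
  obtain ⟨m, -, hm⟩ := exists_mem_eq_sup (univ : Finset (Fin N)) ⟨⟨0, by omega⟩, mem_univ _⟩ c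
  have hmS : c m + ∑ i ∈ univ.erase m, c i = ∑ i, c i := add_sum_erase _ _ (mem_univ m)
  constructor
  · obtain ⟨y, h1, h2⟩ := exists_schedule N hN
      (min B (min ((∑ i, c i) / 2) ((∑ i, c i) - Finset.univ.sup c))) c (by omega) (by
        intro i
        have : c i ≤ univ.sup c := le_sup (mem_univ i)
        omega)
    exact ⟨y, h1, by rw [h2]; exact min_le_left _ _, h2.symm⟩
  · rintro t ⟨y, h1, h2, rfl⟩
    have e := sum_nodeDeg N y
    have l := nodeDeg_le N y m
    have hD : nodeDeg N y m + ∑ i ∈ univ.erase m, nodeDeg N y i = ∑ i, nodeDeg N y i :=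
      add_sum_erase _ _ (mem_univ m)
    have a1 : ∑ i, nodeDeg N y i ≤ ∑ i, c i := sum_le_sum fun i _ => h1 i
    have a2 : ∑ i ∈ univ.erase m, nodeDeg N y i ≤ ∑ i ∈ univ.erase m, c i := sum_le_sum fun i _ => h1 i
    rw [hm]
    omega
end

section
/- Let N ≥ 2, let B and M_1,…,M_N be nonnegative integers, let p ∈ [0,1], and let C = (C_1,…,C_N) be a random vector with independent components C_i ~ Binomial(M_i, p). For a realization c, let E^max(c) = min{ B, ⌊(Σ_i c_i)/2⌋, Σ_i c_i − max_i c_i }. Then the maximum over all functions v assigning to each connectivity state c a point v(c) in the convex hull of 𝒴(c) = { y ∈ ℤ_{≥0}^ℱ : node-degree of y at i ≤ c_i for all i, Σ_{i<j} y_{ij} ≤ B } of the expected total E[ Σ_{i<j} v_{ij}(C) ] equals E[ E^max(C) ] = Σ_c (Π_i binom(M_i, c_i) p^{c_i} (1−p)^{M_i − c_i}) · E^max(c). -/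
open Finset

/-- The index set ℱ of unordered node pairs `(i,j)` with `i < j`. -/
def Pairs (N : ℕ) : Type := {p : Fin N × Fin N // p.1 < p.2}

instance (N : ℕ) : Fintype (Pairs N) := by unfold Pairs; infer_instance

/-- Degree of an integer schedule at node `i`:
`∑_{j<i} y_{ji} + ∑_{j>i} y_{ij}` (each pair containing `i` contributes once). -/
def nodeDegP (N : ℕ) (y : Pairs N → ℕ) (i : Fin N) : ℕ :=
  ∑ p : Pairs N, if p.val.1 = i ∨ p.val.2 = i then y p else 0

/-- Embedding of integer schedules into ℝ^ℱ. -/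
def toRealVec (N : ℕ) (y : Pairs N → ℕ) : Pairs N → ℝ := fun p => (y p : ℝ)

/-- Feasible BSM schedules given connectivity `c` and station budget `B`, as a subset of ℝ^ℱ. -/
def schedSet (N B : ℕ) (c : Fin N → ℕ) : Set (Pairs N → ℝ) :=
  toRealVec N '' {y : Pairs N → ℕ |
    (∀ i, nodeDegP N y i ≤ c i) ∧ (∑ p : Pairs N, y p) ≤ B}

/-- Per-slot maximum number of swaps in connectivity state `c`. -/
def Emax (N B : ℕ) (c : Fin N → ℕ) : ℕ :=
  min B (min ((∑ i, c i) / 2) ((∑ i, c i) - Finset.univ.sup c))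

/-- Probability of connectivity state `c` under independent `Binomial (M i, p)` components. -/
def binomPMF (N : ℕ) (M : Fin N → ℕ) (p : ℝ) (c : (i : Fin N) → Fin (M i + 1)) : ℝ :=
  ∏ i : Fin N, ((M i).choose (c i : ℕ) : ℝ) * p ^ (c i : ℕ) * (1 - p) ^ (M i - (c i : ℕ))


lemma aux_pair {N : ℕ} (a b : Fin N) (h : a ≠ b) :
    ∃ q : Pairs N, ∀ i, (q.val.1 = i ∨ q.val.2 = i) ↔ (i = a ∨ i = b) := by
  rcases lt_or_gt_of_ne h with h | h
  · exact ⟨⟨(a, b), h⟩, fun i => by simp only [eq_comm]⟩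
  · exact ⟨⟨(b, a), h⟩, fun i => by simp only [eq_comm]; tauto⟩

lemma aux_exists {N : ℕ} (hN : 2 ≤ N) (k : ℕ) : ∀ c : Fin N → ℕ,
    2 * k ≤ ∑ i, c i → (∀ i, k + c i ≤ ∑ i, c i) →
    ∃ y : Pairs N → ℕ, (∀ i, nodeDegP N y i ≤ c i) ∧ ∑ p, y p = k := by
  classical
  induction k with
  | zero =>
    intro c _ _
    exact ⟨fun _ => 0, fun i => by simp [nodeDegP], by simp⟩
  | succ k ih =>
    intro c h2 hm
    haveI : Nontrivial (Fin N) := Fin.nontrivial_iff_two_le.mpr hN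
    obtain ⟨a, -, ha⟩ := Finset.exists_max_image (univ : Finset (Fin N)) c Finset.univ_nonempty
    obtain ⟨b, hb, hbm⟩ := Finset.exists_max_image ((univ : Finset (Fin N)).erase a) c
      (by obtain ⟨x, hx⟩ := exists_ne a; exact ⟨x, by simp [hx]⟩)
    have hba : b ≠ a := by simpa using hb
    have hsplit : c a + ∑ i ∈ univ.erase a, c i = ∑ i, c i :=
      Finset.add_sum_erase _ _ (mem_univ a)
    have hbpos : 0 < c b := by
      by_contra h0
      have : ∑ i ∈ univ.erase a, c i = 0 :=
        Finset.sum_eq_zero fun i hi => by have := hbm i hi; omega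
      have := hm a
      omega
    have hapos : 0 < c a := lt_of_lt_of_le hbpos (ha b (mem_univ b))
    let c' : Fin N → ℕ := fun i => c i - if i = a ∨ i = b then 1 else 0
    have hc' : ∀ i, c i = c' i + (if i = a ∨ i = b then 1 else 0) := by
      intro i
      simp only [c']
      split_ifs with h
      · rcases h with rfl | rfl <;> omega
      · omega
    have hS : ∑ i, c i = ∑ i, c' i + 2 := by
      have : ∀ i, c i = c' i + ((if i = a then 1 else 0) + (if i = b then 1 else 0)) := by
        intro i
        rw [hc' i]
        by_cases h1 : i = a
        · subst h1; simp [hba.symm]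
        · simp [h1]
      rw [Finset.sum_congr rfl fun i _ => this i]
      simp [Finset.sum_add_distrib]
    obtain ⟨y, hy, hyk⟩ := ih c' (by omega) (by
      intro i
      have h1 := hc' i
      have h3 := hm i
      by_cases hi : i = a ∨ i = b
      · rw [if_pos hi] at h1; omega
      · rw [if_neg hi] at h1
        push Not at hi
        have h4 := ha b (mem_univ b)
        have h5 := hbm i (by simp [hi.1])
        have h6 : c a + (c b + c i) ≤ ∑ i, c i := by
          have := Finset.sum_le_sum_of_subset (f := c) (Finset.subset_univ ({a, b, i} : Finset (Fin N)))
          rwa [Finset.sum_insert (by simp [hba.symm, hi.1.symm]),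
            Finset.sum_insert (by simp [hi.2.symm]), Finset.sum_singleton] at this
        omega)
    obtain ⟨q, hq⟩ := aux_pair a b hba.symm
    refine ⟨fun p => y p + if p = q then 1 else 0, ?_, ?_⟩
    · intro i
      have : nodeDegP N (fun p => y p + if p = q then 1 else 0) i
          = nodeDegP N y i + if i = a ∨ i = b then 1 else 0 := by
        unfold nodeDegP
        have : ∀ p : Pairs N, (if p.val.1 = i ∨ p.val.2 = i then
            (y p + if p = q then 1 else 0) else 0)
            = (if p.val.1 = i ∨ p.val.2 = i then y p else 0) +
              (if p = q then (if i = a ∨ i = b then 1 else 0) else 0) := by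
          intro p
          by_cases hpq : p = q
          · subst hpq
            simp only [hq i]
            split_ifs <;> simp
          · simp [hpq]
        rw [Finset.sum_congr rfl fun p _ => this p, Finset.sum_add_distrib]
        simp
      rw [this, hc' i]
      exact Nat.add_le_add_right (hy i) _
    · simp [Finset.sum_add_distrib, hyk]

lemma aux_upper {N B : ℕ} (c : Fin N → ℕ) (y : Pairs N → ℕ)
    (hy : ∀ i, nodeDegP N y i ≤ c i) (hB : ∑ p, y p ≤ B) : ∑ p, y p ≤ Emax N B c := by
  classical
  have hdeg : ∀ s : Finset (Fin N), ∑ i ∈ s, nodeDegP N y i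
      = ∑ p : Pairs N, ((if p.val.1 ∈ s then y p else 0) + (if p.val.2 ∈ s then y p else 0)) := by
    intro s
    unfold nodeDegP
    rw [Finset.sum_comm]
    refine Finset.sum_congr rfl fun p _ => ?_
    have hne : p.val.1 ≠ p.val.2 := ne_of_lt p.2
    have : ∀ i, (if p.val.1 = i ∨ p.val.2 = i then y p else 0)
        = (if p.val.1 = i then y p else 0) + (if p.val.2 = i then y p else 0) := by
      intro i
      by_cases h1 : p.val.1 = i
      · have h2 : ¬ p.val.2 = i := fun h => hne (h1.trans h.symm)
        simp [h1, h2]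
      · simp [h1]
    rw [Finset.sum_congr rfl fun i _ => this i, Finset.sum_add_distrib]
    simp
  have h1 : 2 * ∑ p, y p ≤ ∑ i, c i := by
    refine le_trans ?_ (Finset.sum_le_sum fun i _ => hy i)
    rw [hdeg, Finset.mul_sum]
    exact Finset.sum_le_sum fun p _ => by simp; omega
  have h2 : ∀ m, ∑ p, y p + c m ≤ ∑ i, c i := by
    intro m
    have h3 : c m + ∑ i ∈ univ.erase m, c i = ∑ i, c i :=
      Finset.add_sum_erase _ _ (mem_univ m)
    have h4 : ∑ p, y p ≤ ∑ i ∈ univ.erase m, c i := by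
      refine le_trans ?_ (Finset.sum_le_sum fun i _ => hy i)
      rw [hdeg]
      refine Finset.sum_le_sum fun p _ => ?_
      have hne : p.val.1 ≠ p.val.2 := ne_of_lt p.2
      by_cases h : p.val.1 = m
      · have : p.val.2 ≠ m := fun h' => hne (h.trans h'.symm)
        simp [this]
      · simp [h]
    omega
  have h3 : univ.sup c ≤ ∑ i, c i - ∑ p, y p :=
    Finset.sup_le fun m _ => by have := h2 m; omega
  unfold Emax
  refine le_min hB (le_min ?_ ?_) <;> omega

lemma aux_attain {N : ℕ} (hN : 2 ≤ N) (B : ℕ) (c : Fin N → ℕ) :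
    ∃ v ∈ schedSet N B c, ∑ q, v q = (Emax N B c : ℝ) := by
  have hsup : ∀ i, c i ≤ univ.sup c := fun i => Finset.le_sup (f := c) (mem_univ i)
  have hle : univ.sup c ≤ ∑ i, c i :=
    Finset.sup_le fun i _ => Finset.single_le_sum (f := c) (fun _ _ => Nat.zero_le _) (mem_univ i)
  have hE : Emax N B c ≤ B ∧ Emax N B c ≤ (∑ i, c i) / 2 ∧
      Emax N B c ≤ ∑ i, c i - univ.sup c := by
    unfold Emax; omega
  obtain ⟨y, hy, hk⟩ := aux_exists hN (Emax N B c) c (by omega)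
    (fun i => by have := hsup i; omega)
  refine ⟨_, ⟨y, ⟨hy, by omega⟩, rfl⟩, ?_⟩
  simp only [toRealVec]
  exact_mod_cast hk

lemma aux_hull {N B : ℕ} (c : Fin N → ℕ) (v : Pairs N → ℝ)
    (hv : v ∈ convexHull ℝ (schedSet N B c)) : ∑ q, v q ≤ (Emax N B c : ℝ) := by
  have hconv : Convex ℝ {w : Pairs N → ℝ | ∑ q, w q ≤ (Emax N B c : ℝ)} :=
    convex_halfSpace_le ⟨fun x y => by simp [Finset.sum_add_distrib],
      fun r x => by simp [Finset.mul_sum]⟩ _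
  refine convexHull_min ?_ hconv hv
  rintro _ ⟨y, ⟨hy, hB⟩, rfl⟩
  simp only [toRealVec, Set.mem_setOf_eq]
  exact_mod_cast aux_upper c y hy hB

theorem stmt8 (N : ℕ) (hN : 2 ≤ N) (B : ℕ) (M : Fin N → ℕ)
    (p : ℝ) (hp0 : 0 ≤ p) (hp1 : p ≤ 1) :
    IsGreatest
      {t : ℝ | ∃ v : ((i : Fin N) → Fin (M i + 1)) → (Pairs N → ℝ),
        (∀ c, v c ∈ convexHull ℝ (schedSet N B (fun i => (c i : ℕ)))) ∧
        t = ∑ c : (i : Fin N) → Fin (M i + 1),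
              binomPMF N M p c * ∑ q : Pairs N, v c q}
      (∑ c : (i : Fin N) → Fin (M i + 1),
        binomPMF N M p c * (Emax N B (fun i => (c i : ℕ)) : ℝ)) := by
  refine ⟨?_, ?_⟩
  · choose v hv hs using fun c : (i : Fin N) → Fin (M i + 1) =>
      aux_attain hN B (fun i => (c i : ℕ))
    exact ⟨v, fun c => subset_convexHull ℝ _ (hv c), by simp only [hs]⟩
  · rintro t ⟨v, hv, rfl⟩
    refine Finset.sum_le_sum fun c _ => mul_le_mul_of_nonneg_left (aux_hull _ _ (hv c)) ?_
    unfold binomPMF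
    have : 0 ≤ 1 - p := by linarith
    exact Finset.prod_nonneg fun i _ => by positivity
end
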